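/- For k = 1,2 let H_k = S_k⁻ᵀD_kS_k⁻¹ be Hamiltonian matrices with symplectic diagonalizations and V_k := (1/2)·S_k·coth(D_k)·S_kᵀ the corresponding covariance matrices, and set K_k := 2·(2iΩV_k − I)⁻¹. Write S := S₁ and d_max for the largest diagonal entry of D₁. If ‖K₁ − K₂‖∞ < e^{−2 d_max}·‖S‖∞⁻², then ‖H₁ − H₂‖∞ ≤ (1/2)·e^{2 d_max}·‖S‖∞²·‖K₁ − K₂‖∞·(1 + (e^{2 d_max}‖S‖∞²(1 − e^{−2 d_max}) + ‖K₁ − K₂‖∞)/(e^{−2 d_max}‖S‖∞⁻² − ‖K₁ − K₂‖∞)). -/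

import Mathlib

open Matrix

/-- The spectral norm (ℓ²→ℓ² operator norm, largest singular value) of a matrix. -/
noncomputable def spNorm {𝕜 : Type*} [RCLike 𝕜] {p q : Type*} [Fintype p] [Fintype q]
    [DecidableEq q] (A : Matrix p q 𝕜) : ℝ :=
  ‖LinearMap.toContinuousLinearMap (Matrix.toEuclideanLin A)‖

/-- Index set for `2m × 2m` matrices: the pair `(i, δ)` stands for the index `2i - δ`,
`(i, 0)` being the first index of the `i`-th pair and `(i, 1)` the second. -/
abbrev Idx (m : ℕ) := Fin m × Fin 2

/-- The standard symplectic form: block diagonal with `m` blocks `[[0,1],[-1,0]]`. -/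
def Omega (m : ℕ) : Matrix (Idx m) (Idx m) ℝ :=
  Matrix.of fun p q =>
    if p.1 = q.1 ∧ p.2 = 0 ∧ q.2 = 1 then 1
    else if p.1 = q.1 ∧ p.2 = 1 ∧ q.2 = 0 then -1 else 0

/-- The diagonal matrix `diag (d₁, d₁, …, d_m, d_m)`. -/
def pairDiag {m : ℕ} (d : Fin m → ℝ) : Matrix (Idx m) (Idx m) ℝ :=
  Matrix.diagonal fun p => d p.1

/-- Hyperbolic cotangent. -/
noncomputable def rcoth (x : ℝ) : ℝ := Real.cosh x / Real.sinh x

/-- A real matrix regarded as a complex matrix. -/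
def cplx {p q : Type*} (A : Matrix p q ℝ) : Matrix p q ℂ :=
  A.map (fun x => (x : ℂ))


section Aux
open scoped Matrix.Norms.L2Operator

/-- Conjugated real diagonal matrix. -/
noncomputable def cjd {n : Type*} [Fintype n] [DecidableEq n] (T T' : Matrix n n ℂ) (v : n → ℝ) :
    Matrix n n ℂ := T * diagonal (fun p => (v p : ℂ)) * T'

theorem cjd_mul {n : Type*} [Fintype n] [DecidableEq n] {T T' : Matrix n n ℂ} (h : T' * T = 1)
    (v w : n → ℝ) : cjd T T' v * cjd T T' w = cjd T T' (fun p => v p * w p) := by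
  unfold cjd
  calc _ = T * diagonal (fun p => (v p : ℂ)) * (T' * T) * diagonal (fun p => (w p : ℂ)) * T' := by
        simp only [Matrix.mul_assoc]
    _ = _ := by
        rw [h, Matrix.mul_one, Matrix.mul_assoc T, diagonal_mul_diagonal]
        simp

theorem cjd_one {n : Type*} [Fintype n] [DecidableEq n] {T T' : Matrix n n ℂ} (h : T * T' = 1) :
    cjd T T' (fun _ => 1) = 1 := by
  simp [cjd, h]

theorem cjd_add {n : Type*} [Fintype n] [DecidableEq n] (T T' : Matrix n n ℂ)
    (v w : n → ℝ) : cjd T T' (v + w) = cjd T T' v + cjd T T' w := by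
  unfold cjd
  rw [← Matrix.add_mul, ← Matrix.mul_add, diagonal_add]
  simp

theorem cjd_smul {n : Type*} [Fintype n] [DecidableEq n] (T T' : Matrix n n ℂ)
    (c : ℝ) (v : n → ℝ) : cjd T T' (c • v) = c • cjd T T' v := by
  unfold cjd
  rw [← Matrix.smul_mul, ← Matrix.mul_smul, ← diagonal_smul]
  congr 3
  ext p
  simp

theorem cjd_norm {n : Type*} [Fintype n] [DecidableEq n] (T T' : Matrix n n ℂ)
    (v : n → ℝ) (c N : ℝ) (hc : 0 ≤ c) (hN : ‖T‖ * ‖T'‖ ≤ N) (hv : ∀ p, |v p| ≤ c) :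
    ‖cjd T T' v‖ ≤ N * c := by
  unfold cjd
  have h1 : ‖(diagonal (fun p => (v p : ℂ)) : Matrix n n ℂ)‖ ≤ c := by
    rw [l2_opNorm_diagonal, pi_norm_le_iff_of_nonneg hc]
    intro p
    simpa using hv p
  calc _ ≤ ‖T‖ * ‖(diagonal (fun p => (v p : ℂ)) : Matrix n n ℂ)‖ * ‖T'‖ :=
        (l2_opNorm_mul _ _).trans (by gcongr; exact l2_opNorm_mul _ _)
    _ = (‖T‖ * ‖T'‖) * ‖(diagonal (fun p => (v p : ℂ)) : Matrix n n ℂ)‖ := by ring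
    _ ≤ _ := by gcongr; exact (by positivity : (0:ℝ) ≤ ‖T‖ * ‖T'‖).trans hN

theorem cjd_deriv {n : Type*} [Fintype n] [DecidableEq n] (T T' : Matrix n n ℂ)
    (v : ℝ → n → ℝ) (v' : n → ℝ) (s : ℝ) (h : ∀ p, HasDerivAt (fun t => v t p) (v' p) s) :
    HasDerivAt (fun t => cjd T T' (v t)) (cjd T T' v') s := by
  let L : (n → ℝ) →ₗ[ℝ] Matrix n n ℂ :=
    { toFun := cjd T T'
      map_add' := cjd_add T T'
      map_smul' := cjd_smul T T' }
  have h2 := (LinearMap.toContinuousLinearMap L).hasFDerivAt (x := v s)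
  exact h2.comp_hasDerivAt s (hasDerivAt_pi.2 h)

theorem pos_aux (s e : ℝ) (h0 : 0 ≤ s) (h1 : s ≤ 1) (d : ℝ) (hd : 0 ≤ d) (he : -d ≤ e) :
    Real.exp (-2 * d) ≤ 1 + s * (Real.exp (2 * e) - 1) := by
  have a1 : Real.exp (-2 * d) ≤ 1 := by
    rw [Real.exp_le_one_iff]; linarith
  have a2 : Real.exp (-2 * d) ≤ Real.exp (2 * e) := by
    rw [Real.exp_le_exp]; linarith
  nlinarith

theorem pos_aux' (s e : ℝ) (h0 : 0 ≤ s) (h1 : s ≤ 1) :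
    0 < 1 + s * (Real.exp (2 * e) - 1) :=
  (Real.exp_pos _).trans_le (pos_aux s e h0 h1 |e| (abs_nonneg e) (neg_abs_le e))

theorem abs_main {n : Type*} [Fintype n] [DecidableEq n] [Nonempty n]
    (T₁ T₁' T₂ T₂' : Matrix n n ℂ) (h₁ : T₁ * T₁' = 1) (h₁' : T₁' * T₁ = 1)
    (h₂ : T₂ * T₂' = 1) (h₂' : T₂' * T₂ = 1) (e₁ e₂ : n → ℝ) (d N ε : ℝ)
    (hd : 0 ≤ d) (hN : 0 < N) (he : ∀ p, |e₁ p| ≤ d) (hT : ‖T₁‖ * ‖T₁'‖ ≤ N)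
    (K₁ K₂ : Matrix n n ℂ)
    (hK₁ : K₁ = cjd T₁ T₁' (fun p => Real.exp (2 * e₁ p) - 1))
    (hK₂ : K₂ = cjd T₂ T₂' (fun p => Real.exp (2 * e₂ p) - 1))
    (hε : ε = ‖K₁ - K₂‖) (hlt : ε < Real.exp (-2 * d) * N⁻¹) :
    ‖cjd T₁ T₁' e₁ - cjd T₂ T₂' e₂‖ ≤ (1/2) * Real.exp (2 * d) * N * ε *
        (1 + (Real.exp (2 * d) * N * (1 - Real.exp (-2 * d)) + ε) /
            (Real.exp (-2 * d) * N⁻¹ - ε)) := by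
  have hε0 : 0 ≤ ε := hε ▸ norm_nonneg _
  have hx : Real.exp (2 * d) * Real.exp (-2 * d) = 1 := by
    rw [← Real.exp_add]; simp
  have hep := Real.exp_pos (2 * d)
  have hen := Real.exp_pos (-2 * d)
  set a := Real.exp (-2 * d) * N⁻¹ with ha
  set r := N * Real.exp (2 * d) with hr
  have hra : r * a = 1 := by
    rw [hr, ha]
    calc _ = (N * N⁻¹) * (Real.exp (2 * d) * Real.exp (-2 * d)) := by ring
      _ = 1 := by rw [hx, mul_inv_cancel₀ hN.ne']; norm_num
  have hr0 : 0 < r := by positivity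
  have hae : 0 < a - ε := by linarith
  -- norm of K₁
  have hK1n : ‖K₁‖ ≤ N * (Real.exp (2 * d) - 1) := by
    rw [hK₁]
    have h1e : 1 ≤ Real.exp (2 * d) := Real.one_le_exp (by linarith)
    refine cjd_norm _ _ _ _ _ (by linarith) hT fun p => ?_
    have b := abs_le.1 (he p)
    rw [abs_le]
    have c1 : Real.exp (2 * e₁ p) ≤ Real.exp (2 * d) := Real.exp_le_exp.2 (by linarith)
    have c2 : Real.exp (-2 * d) ≤ Real.exp (2 * e₁ p) := Real.exp_le_exp.2 (by linarith)
    constructor <;> nlinarith [sq_nonneg (Real.exp (2 * d) - 1)]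
  have hK2n : ‖K₂‖ ≤ N * (Real.exp (2 * d) - 1) + ε := by
    calc ‖K₂‖ = ‖K₁ - (K₁ - K₂)‖ := by congr 1; abel
      _ ≤ ‖K₁‖ + ‖K₁ - K₂‖ := norm_sub_le _ _
      _ ≤ _ := by rw [← hε]; linarith
  set M := 1 + (Real.exp (2 * d) * N * (1 - Real.exp (-2 * d)) + ε) / (a - ε) with hM
  have hM' : M = 1 + (N * (Real.exp (2 * d) - 1) + ε) / (a - ε) := by
    rw [hM]; congr 3; linear_combination (-N) * hx
  let F : ℝ → Matrix n n ℂ := fun s =>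
    cjd T₁ T₁' (fun p => Real.log (1 + s * (Real.exp (2 * e₁ p) - 1)))
     - cjd T₂ T₂' (fun p => Real.log (1 + s * (Real.exp (2 * e₂ p) - 1)))
  let F' : ℝ → Matrix n n ℂ := fun s =>
    cjd T₁ T₁' (fun p => (Real.exp (2 * e₁ p) - 1) / (1 + s * (Real.exp (2 * e₁ p) - 1)))
     - cjd T₂ T₂' (fun p => (Real.exp (2 * e₂ p) - 1) / (1 + s * (Real.exp (2 * e₂ p) - 1)))
  have key := norm_image_sub_le_of_norm_deriv_le_segment_01' (f := F) (f' := F') (C := r * ε * M)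
    ?_ ?_
  · have e0 : F 0 = 0 := by
      simp [F, cjd]
    have e1 : F 1 = (2:ℝ) • (cjd T₁ T₁' e₁ - cjd T₂ T₂' e₂) := by
      simp only [F, smul_sub, ← cjd_smul]
      congr 2 <;> ext p <;> simp
    rw [e0, e1, sub_zero, norm_smul] at key
    simp only [Real.norm_ofNat] at key
    rw [hr] at key
    linarith
  · rintro s ⟨h0, h1⟩
    refine (HasDerivAt.sub ?_ ?_).hasDerivWithinAt
    all_goals
      refine cjd_deriv _ _ _ _ _ fun p => ?_
      refine HasDerivAt.log ?_ (pos_aux' _ _ h0 h1).ne'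
      simpa using ((hasDerivAt_id s).mul_const _).const_add 1
  · rintro s ⟨h0, h1⟩
    have h1 := h1.le
    set R₁ := cjd T₁ T₁' (fun p => (1 + s * (Real.exp (2 * e₁ p) - 1))⁻¹) with hR₁
    set R₂ := cjd T₂ T₂' (fun p => (1 + s * (Real.exp (2 * e₂ p) - 1))⁻¹) with hR₂
    have q1 : ∀ (T T' : Matrix n n ℂ) (h : T * T' = 1) (e : n → ℝ),
        1 + s • cjd T T' (fun p => Real.exp (2 * e p) - 1)
          = cjd T T' (fun p => 1 + s * (Real.exp (2 * e p) - 1)) := by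
      intro T T' h e
      rw [← cjd_smul, ← cjd_one h, ← cjd_add]
      rfl
    have i1 : R₁ * (1 + s • K₁) = 1 := by
      rw [hK₁, q1 _ _ h₁, hR₁, cjd_mul h₁', ← cjd_one h₁]
      congr 1; ext p
      exact inv_mul_cancel₀ (pos_aux' _ _ h0 h1).ne'
    have i2 : (1 + s • K₂) * R₂ = 1 := by
      rw [hK₂, q1 _ _ h₂, hR₂, cjd_mul h₂', ← cjd_one h₂]
      congr 1; ext p
      exact mul_inv_cancel₀ (pos_aux' _ _ h0 h1).ne'
    have hF' : F' s = R₁ * (K₁ - K₂) * R₂ := by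
      have j1 : R₁ * K₁ = cjd T₁ T₁'
          (fun p => (Real.exp (2 * e₁ p) - 1) / (1 + s * (Real.exp (2 * e₁ p) - 1))) := by
        rw [hR₁, hK₁, cjd_mul h₁']; congr 1; ext p; rw [div_eq_inv_mul]
      have j2 : K₂ * R₂ = cjd T₂ T₂'
          (fun p => (Real.exp (2 * e₂ p) - 1) / (1 + s * (Real.exp (2 * e₂ p) - 1))) := by
        rw [hR₂, hK₂, cjd_mul h₂']; congr 1
      calc F' s = R₁ * K₁ - K₂ * R₂ := by rw [j1, j2]
        _ = R₁ * K₁ * ((1 + s • K₂) * R₂) - (R₁ * (1 + s • K₁)) * (K₂ * R₂) := by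
            rw [i1, i2, one_mul, mul_one]
        _ = _ := by
            simp only [mul_add, add_mul, mul_sub, sub_mul, one_mul, mul_one, smul_mul_assoc,
              mul_smul_comm, mul_assoc]
            abel
    have n1 : ‖R₁‖ ≤ r := by
      refine cjd_norm _ _ _ _ _ hep.le hT fun p => ?_
      have b := abs_le.1 (he p)
      have c := pos_aux s (e₁ p) h0 h1 d hd b.1
      rw [abs_of_pos (inv_pos.2 (pos_aux' _ _ h0 h1))]
      have : Real.exp (2 * d) = (Real.exp (-2 * d))⁻¹ := eq_inv_of_mul_eq_one_left hx
      rw [this]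
      gcongr
    have n2 : ‖R₂‖ ≤ 1 / (a - ε) := by
      have k : R₂ = R₁ + s • (R₁ * (K₁ - K₂) * R₂) := by
        calc R₂ = (R₁ * (1 + s • K₁)) * R₂ := by rw [i1, one_mul]
          _ = R₁ * ((1 + s • K₂) * R₂) + s • (R₁ * (K₁ - K₂) * R₂) := by
            simp only [mul_add, add_mul, mul_sub, sub_mul, one_mul, mul_one, smul_mul_assoc,
              mul_smul_comm, mul_assoc, smul_sub]
            abel
          _ = _ := by rw [i2, mul_one]
      have k2 : ‖R₂‖ ≤ r + r * ε * ‖R₂‖ := by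
        calc ‖R₂‖ = ‖R₁ + s • (R₁ * (K₁ - K₂) * R₂)‖ := by rw [← k]
          _ ≤ ‖R₁‖ + ‖s • (R₁ * (K₁ - K₂) * R₂)‖ := norm_add_le _ _
          _ ≤ r + 1 * (r * ε * ‖R₂‖) := by
            rw [norm_smul, hε]
            gcongr
            · rw [Real.norm_eq_abs, abs_of_nonneg h0]; exact h1
            · refine (norm_mul_le _ _).trans ?_
              gcongr
              refine (norm_mul_le _ _).trans ?_
              gcongr
          _ = _ := by ring
      rw [le_div_iff₀ hae]
      have k3 := mul_le_mul_of_nonneg_left k2 (show 0 ≤ a by positivity)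
      have k4 : a * (r + r * ε * ‖R₂‖) = 1 + ε * ‖R₂‖ := by
        linear_combination (1 + ε * ‖R₂‖) * hra
      linarith
    have n3 : ‖R₂‖ ≤ M := by
      have k : R₂ = 1 - s • (K₂ * R₂) := by
        rw [eq_sub_iff_add_eq, ← i2, add_mul, one_mul, smul_mul_assoc]
      calc ‖R₂‖ = ‖1 - s • (K₂ * R₂)‖ := by rw [← k]
        _ ≤ ‖(1 : Matrix n n ℂ)‖ + ‖s • (K₂ * R₂)‖ := norm_sub_le _ _
        _ ≤ 1 + 1 * ((N * (Real.exp (2 * d) - 1) + ε) * (1 / (a - ε))) := by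
            rw [norm_smul, CStarRing.norm_one]
            gcongr
            · rw [Real.norm_eq_abs, abs_of_nonneg h0]; exact h1
            · refine (norm_mul_le _ _).trans ?_
              gcongr
              exact (norm_nonneg _).trans hK2n
        _ = M := by rw [hM']; ring
    rw [hF']
    refine (norm_mul_le _ _).trans ?_
    gcongr
    refine (norm_mul_le _ _).trans ?_
    rw [← hε]
    gcongr

theorem spNorm_eq {𝕜 : Type*} [RCLike 𝕜] {n : Type*} [Fintype n] [DecidableEq n]
    (A : Matrix n n 𝕜) : spNorm A = ‖A‖ := rfl

theorem norm_cplx_le {n : Type*} [Fintype n] [DecidableEq n] (A : Matrix n n ℝ) :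
    ‖cplx A‖ ≤ ‖A‖ := by
  rw [cstar_norm_def (cplx A)]
  refine ContinuousLinearMap.opNorm_le_bound _ (norm_nonneg _) fun x => ?_
  refine (sq_le_sq₀ (by positivity) (by positivity)).mp ?_
  let u : EuclideanSpace ℝ n := WithLp.toLp 2 (fun i => (x i).re)
  let w : EuclideanSpace ℝ n := WithLp.toLp 2 (fun i => (x i).im)
  have hu := (toEuclideanCLM (n := n) (𝕜 := ℝ) A).le_opNorm u
  have hw := (toEuclideanCLM (n := n) (𝕜 := ℝ) A).le_opNorm w
  rw [← cstar_norm_def] at hu hw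
  have hu2 := pow_le_pow_left₀ (norm_nonneg _) hu 2
  have hw2 := pow_le_pow_left₀ (norm_nonneg _) hw 2
  have e1 : ‖x‖ ^ 2 = ‖u‖ ^ 2 + ‖w‖ ^ 2 := by
    simp only [EuclideanSpace.norm_sq_eq, ← Finset.sum_add_distrib]
    refine Finset.sum_congr rfl fun i _ => ?_
    simp [u, w, Complex.sq_norm, Complex.normSq_apply]
    ring
  have e2 : ‖toEuclideanCLM (n := n) (𝕜 := ℂ) (cplx A) x‖ ^ 2 =
      ‖toEuclideanCLM (n := n) (𝕜 := ℝ) A u‖ ^ 2 + ‖toEuclideanCLM (n := n) (𝕜 := ℝ) A w‖ ^ 2 := by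
    simp only [EuclideanSpace.norm_sq_eq, ← Finset.sum_add_distrib]
    refine Finset.sum_congr rfl fun i _ => ?_
    simp only [ofLp_toEuclideanCLM, mulVec, dotProduct, cplx, Matrix.map_apply, u, w,
      Complex.sq_norm, Complex.normSq_apply, Complex.re_sum, Complex.im_sum,
      Complex.re_ofReal_mul, Complex.im_ofReal_mul, Real.norm_eq_abs, sq_abs]
    ring
  rw [e2, mul_pow, e1]
  rw [mul_pow] at hu2 hw2
  linarith

theorem norm_le_cplx {n : Type*} [Fintype n] [DecidableEq n] (A : Matrix n n ℝ) :
    ‖A‖ ≤ ‖cplx A‖ := by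
  rw [cstar_norm_def A]
  refine ContinuousLinearMap.opNorm_le_bound _ (norm_nonneg _) fun x => ?_
  let u : EuclideanSpace ℂ n := WithLp.toLp 2 (fun i => (x i : ℂ))
  have hu := (toEuclideanCLM (n := n) (𝕜 := ℂ) (cplx A)).le_opNorm u
  rw [← cstar_norm_def] at hu
  have e1 : ‖u‖ = ‖x‖ := by
    simp [EuclideanSpace.norm_eq, u]
  have e2 : ‖toEuclideanCLM (n := n) (𝕜 := ℂ) (cplx A) u‖ =
      ‖toEuclideanCLM (n := n) (𝕜 := ℝ) A x‖ := by
    simp only [EuclideanSpace.norm_eq]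
    congr 1
    refine Finset.sum_congr rfl fun i _ => ?_
    simp only [ofLp_toEuclideanCLM, mulVec, dotProduct, cplx, Matrix.map_apply, u]
    rw [← Complex.norm_real]
    simp
  rw [e1, e2] at hu
  exact hu

theorem cplx_mul {n : Type*} [Fintype n] (A B : Matrix n n ℝ) :
    cplx (A * B) = cplx A * cplx B := by
  unfold cplx
  exact Matrix.map_mul (f := Complex.ofRealHom)

theorem cplx_sub {n : Type*} (A B : Matrix n n ℝ) :
    cplx (A - B) = cplx A - cplx B := by
  ext; simp [cplx]

theorem cplx_one {n : Type*} [DecidableEq n] :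
    cplx (1 : Matrix n n ℝ) = 1 := by
  ext i j; by_cases h : i = j <;> simp [cplx, Matrix.one_apply, h]

theorem cplx_smul {n : Type*} (c : ℝ) (A : Matrix n n ℝ) :
    cplx (c • A) = (c : ℂ) • cplx A := by
  ext; simp [cplx]

theorem cplx_transpose {n : Type*} (A : Matrix n n ℝ) :
    cplx Aᵀ = (cplx A)ᴴ := by
  ext; simp [cplx]

theorem Omega_transpose (m : ℕ) : (Omega m)ᵀ = - Omega m := by
  ext ⟨i, a⟩ ⟨j, b⟩
  by_cases hij : i = j
  · subst hij
    fin_cases a <;> fin_cases b <;> simp [Omega]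
  · fin_cases a <;> fin_cases b <;> simp [Omega, hij, Ne.symm hij]

theorem Omega_sq (m : ℕ) : Omega m * Omega m = -1 := by
  ext ⟨i, a⟩ ⟨j, b⟩
  rw [Matrix.mul_apply]
  simp only [Fintype.sum_prod_type, Fin.sum_univ_two]
  rw [Finset.sum_eq_single i]
  · by_cases hij : i = j
    · subst hij
      fin_cases a <;> fin_cases b <;> simp [Omega]
    · simp [Omega, hij, Matrix.one_apply]
  · intro k _ hk
    simp [Omega, hk.symm]
  · simp

/-- The unitary diagonalizing `iΩ`. -/
noncomputable def UU (m : ℕ) : Matrix (Idx m) (Idx m) ℂ :=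
  Matrix.of fun p q => if p.1 = q.1 then
    ((√2 : ℝ) : ℂ)⁻¹ * (if p.2 = 0 then 1 else if q.2 = 0 then -Complex.I else Complex.I) else 0

/-- signs -/
def sgn2 (a : Fin 2) : ℝ := if a = 0 then 1 else -1

theorem sqrt_aux : ((√2 : ℝ) : ℂ)⁻¹ * ((√2 : ℝ) : ℂ)⁻¹ = 1/2 := by
  rw [← mul_inv, ← Complex.ofReal_mul, Real.mul_self_sqrt (by norm_num)]
  norm_num

theorem UU_diag (m : ℕ) (f : Fin 2 → Fin m → ℂ) :
    UU m * diagonal (fun p => f p.2 p.1) * (UU m)ᴴ = Matrix.of fun p q : Idx m =>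
      if p.1 = q.1 then (if p.2 = q.2 then (f 0 p.1 + f 1 p.1) / 2 else
        if p.2 = 0 then Complex.I * (f 0 p.1 - f 1 p.1) / 2
        else -Complex.I * (f 0 p.1 - f 1 p.1) / 2) else 0 := by
  ext ⟨i, a⟩ ⟨j, b⟩
  have h := sqrt_aux
  have hI := Complex.I_mul_I
  rw [Matrix.mul_apply]
  simp only [Matrix.mul_diagonal, Fintype.sum_prod_type, Fin.sum_univ_two, conjTranspose_apply,
    UU, Matrix.of_apply]
  by_cases hij : i = j
  · subst hij
    rw [Finset.sum_eq_single i]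
    · fin_cases a <;> fin_cases b <;> simp <;> grind
    · intro k _ hk
      simp [hk.symm]
    · simp
  · rw [Finset.sum_eq_zero]
    · simp [hij]
    · intro k _
      by_cases hk : i = k
      · subst hk
        simp [Ne.symm hij]
      · simp [hk]

theorem UU_mul (m : ℕ) : UU m * (UU m)ᴴ = 1 := by
  have := UU_diag m (fun _ _ => 1)
  rw [diagonal_one, Matrix.mul_one] at this
  rw [this]
  ext ⟨i, a⟩ ⟨j, b⟩
  fin_cases a <;> fin_cases b <;> simp [Matrix.one_apply]

theorem UU_mul' (m : ℕ) : (UU m)ᴴ * UU m = 1 := mul_eq_one_comm.1 (UU_mul m)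

theorem UU_omega (m : ℕ) (d : Fin m → ℝ) :
    Complex.I • (cplx (Omega m) * cplx (pairDiag d)) =
      cjd (UU m) (UU m)ᴴ (fun p => sgn2 p.2 * d p.1) := by
  unfold cjd
  rw [UU_diag m (fun a i => ((sgn2 a * d i : ℝ) : ℂ))]
  ext ⟨i, a⟩ ⟨j, b⟩
  by_cases hij : i = j
  · subst hij
    fin_cases a <;> fin_cases b <;>
      simp [cplx, pairDiag, sgn2, Omega, Matrix.mul_apply, diagonal_apply] <;> ring
  · fin_cases a <;> fin_cases b <;>
      simp [cplx, pairDiag, sgn2, Omega, Matrix.mul_apply, diagonal_apply, hij]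

theorem omega_comm (m : ℕ) (d : Fin m → ℝ) : 
    cplx (Omega m) * cplx (pairDiag d) = cplx (pairDiag d) * cplx (Omega m) := by
  rw [← cplx_mul, ← cplx_mul]
  congr 1
  ext ⟨i, a⟩ ⟨j, b⟩
  simp only [pairDiag, Matrix.mul_diagonal, Matrix.diagonal_mul]
  by_cases hij : i = j
  · subst hij
    ring
  · simp [Omega, hij]

theorem symp_inv {m : ℕ} {S : Matrix (Idx m) (Idx m) ℝ} (hS : S * Omega m * Sᵀ = Omega m) :
    S⁻¹ = -(Omega m * Sᵀ * Omega m) := by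
  apply Matrix.inv_eq_right_inv
  rw [Matrix.mul_neg, ← Matrix.mul_assoc, ← Matrix.mul_assoc, hS, Omega_sq, neg_neg]

theorem symp_inv_mul {m : ℕ} {S : Matrix (Idx m) (Idx m) ℝ} (hS : S * Omega m * Sᵀ = Omega m) :
    S⁻¹ * S = 1 ∧ S * S⁻¹ = 1 := by
  have : S * S⁻¹ = 1 := by
    rw [symp_inv hS, Matrix.mul_neg, ← Matrix.mul_assoc, ← Matrix.mul_assoc, hS, Omega_sq, neg_neg]
  exact ⟨mul_eq_one_comm.1 this, this⟩

theorem symp_a {m : ℕ} {S : Matrix (Idx m) (Idx m) ℝ} (hS : S * Omega m * Sᵀ = Omega m) :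
    S⁻¹ * Omega m = Omega m * Sᵀ := by
  rw [symp_inv hS, Matrix.neg_mul, Matrix.mul_assoc, Omega_sq]
  simp

theorem symp_b {m : ℕ} {S : Matrix (Idx m) (Idx m) ℝ} (hS : S * Omega m * Sᵀ = Omega m) :
    Omega m * S = (S⁻¹)ᵀ * Omega m := by
  rw [symp_inv hS]
  simp only [transpose_neg, transpose_mul, Omega_transpose, transpose_transpose, Matrix.mul_assoc,
    Matrix.neg_mul, Matrix.mul_neg, Omega_sq]
  simp

theorem rcoth_aux (x : ℝ) (hx : 0 < x) (a : Fin 2) :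
    (sgn2 a * rcoth x - 1) * ((Real.exp (2 * (sgn2 a * x)) - 1) / 2) = 1 := by
  have h1 : Real.exp x * Real.exp (-x) = 1 := by rw [← Real.exp_add]; simp
  have hs : 0 < Real.sinh x := Real.sinh_pos_iff.2 hx
  have hs' := hs.ne'
  have e2 : Real.exp (2 * x) = Real.exp x ^ 2 := by rw [← Real.exp_nat_mul]; norm_num
  have e3 : Real.exp (-(2 * x)) = Real.exp (-x) ^ 2 := by
    rw [← Real.exp_nat_mul]; congr 1; push_cast; ring
  unfold rcoth
  have key : sgn2 a * (Real.cosh x / Real.sinh x) - 1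
     = (sgn2 a * Real.cosh x - Real.sinh x) / Real.sinh x := by field_simp
  rw [key, div_mul_eq_mul_div, div_eq_one_iff_eq hs']
  rw [Real.cosh_eq, Real.sinh_eq]
  fin_cases a
  · simp [sgn2, e2]
    grind
  · simp [sgn2, e3]
    grind

theorem conc {m : ℕ} (S : Matrix (Idx m) (Idx m) ℝ) (hS : S * Omega m * Sᵀ = Omega m)
    (d : Fin m → ℝ) (hd : ∀ i, 0 < d i) (H V : Matrix (Idx m) (Idx m) ℝ)
    (hH : H = (S⁻¹)ᵀ * pairDiag d * S⁻¹)
    (hV : V = (1/2 : ℝ) • (S * pairDiag (fun i => rcoth (d i)) * Sᵀ))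
    (K : Matrix (Idx m) (Idx m) ℂ)
    (hK : K = (2 : ℂ) • ((2 * Complex.I) • (cplx (Omega m) * cplx V) - 1)⁻¹) :
    ∃ T T' : Matrix (Idx m) (Idx m) ℂ, T * T' = 1 ∧ T' * T = 1 ∧
      (0 < m → ‖T‖ * ‖T'‖ ≤ ‖S‖ ^ 2) ∧
      K = cjd T T' (fun p => Real.exp (2 * (sgn2 p.2 * d p.1)) - 1) ∧
      cplx H * (Complex.I • cplx (Omega m)) = cjd T T' (fun p => sgn2 p.2 * d p.1) := by
  have hi := symp_inv_mul hS
  have hc : cplx (S⁻¹)ᵀ * cplx Sᵀ = 1 := by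
    rw [← cplx_mul, ← transpose_mul, hi.2, transpose_one, cplx_one]
  have hTT : cplx (S⁻¹)ᵀ * UU m * ((UU m)ᴴ * cplx Sᵀ) = 1 := by
    calc _ = cplx (S⁻¹)ᵀ * (UU m * (UU m)ᴴ) * cplx Sᵀ := by simp only [Matrix.mul_assoc]
      _ = 1 := by rw [UU_mul, Matrix.mul_one, hc]
  have hcj : ∀ v, cjd (cplx (S⁻¹)ᵀ * UU m) ((UU m)ᴴ * cplx Sᵀ) v
      = cplx (S⁻¹)ᵀ * cjd (UU m) (UU m)ᴴ v * cplx Sᵀ := by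
    intro v
    simp only [cjd, Matrix.mul_assoc]
  refine ⟨cplx (S⁻¹)ᵀ * UU m, (UU m)ᴴ * cplx Sᵀ, hTT, mul_eq_one_comm.1 hTT, ?_, ?_, ?_⟩
  · intro hm
    haveI : Nonempty (Idx m) := ⟨(⟨0, hm⟩, 0)⟩
    have hU : ‖UU m‖ = 1 :=
      CStarRing.norm_of_mem_unitary (Unitary.mem_iff.2 ⟨UU_mul' m, UU_mul m⟩)
    have hO : ‖Omega m‖ = 1 := by
      apply CStarRing.norm_of_mem_unitary
      have hst : star (Omega m) = - Omega m := by
        rw [star_eq_conjTranspose, conjTranspose_eq_transpose_of_trivial, Omega_transpose]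
      rw [Unitary.mem_iff, hst]
      simp [Omega_sq]
    have hSt : ‖cplx Sᵀ‖ ≤ ‖S‖ := by
      rw [cplx_transpose, l2_opNorm_conjTranspose]; exact norm_cplx_le S
    have hSi : ‖cplx (S⁻¹)ᵀ‖ ≤ ‖S‖ := by
      rw [cplx_transpose, l2_opNorm_conjTranspose]
      refine (norm_cplx_le _).trans ?_
      rw [symp_inv hS, norm_neg]
      refine (norm_mul_le _ _).trans ?_
      rw [hO, mul_one]
      refine (norm_mul_le _ _).trans ?_
      rw [hO, one_mul, ← conjTranspose_eq_transpose_of_trivial, l2_opNorm_conjTranspose]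
    have a1 := norm_mul_le (cplx (S⁻¹)ᵀ) (UU m)
    have a2 := norm_mul_le (UU m)ᴴ (cplx Sᵀ)
    rw [l2_opNorm_conjTranspose, hU, one_mul] at a2
    rw [hU, mul_one] at a1
    rw [sq]
    exact mul_le_mul (a1.trans hSi) (a2.trans hSt) (norm_nonneg _) (norm_nonneg _)
  · have e : (2 * Complex.I) • (cplx (Omega m) * cplx V) - 1 =
        cjd (cplx (S⁻¹)ᵀ * UU m) ((UU m)ᴴ * cplx Sᵀ) (fun p => sgn2 p.2 * rcoth (d p.1) - 1) := by
      have : (fun p : Idx m => sgn2 p.2 * rcoth (d p.1) - 1) =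
          (fun p : Idx m => sgn2 p.2 * rcoth (d p.1)) + (-1 : ℝ) • (fun _ => 1) := by
        ext p; simp; ring
      rw [this, cjd_add, cjd_smul, cjd_one hTT, hcj, ← UU_omega m (fun i => rcoth (d i)), hV,
        cplx_smul, cplx_mul, cplx_mul, Matrix.mul_smul, smul_smul, neg_one_smul, ← sub_eq_add_neg,
        ← Matrix.mul_assoc, ← Matrix.mul_assoc, ← cplx_mul (Omega m) S, symp_b hS, cplx_mul]
      congr 1
      rw [Matrix.mul_smul, Matrix.smul_mul]
      congr 1
      · push_cast; ring
      · simp only [Matrix.mul_assoc]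
    have e2 : ((2 * Complex.I) • (cplx (Omega m) * cplx V) - 1)⁻¹ =
       cjd (cplx (S⁻¹)ᵀ * UU m) ((UU m)ᴴ * cplx Sᵀ)
        (fun p => (Real.exp (2 * (sgn2 p.2 * d p.1)) - 1) / 2) := by
      apply Matrix.inv_eq_right_inv
      rw [e, cjd_mul (mul_eq_one_comm.1 hTT), ← cjd_one hTT]
      congr 1
      ext p
      exact rcoth_aux _ (hd _) _
    rw [hK, e2]
    have : (2 : ℂ) = ((2 : ℝ) : ℂ) := by norm_num
    rw [this, Complex.coe_smul, ← cjd_smul]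
    congr 1
    ext p
    simp
    ring
  · rw [hcj, ← UU_omega, hH, omega_comm, cplx_mul, cplx_mul, Matrix.mul_smul, Matrix.mul_assoc,
      ← cplx_mul S⁻¹, symp_a hS, cplx_mul, Matrix.mul_smul, Matrix.smul_mul]
    simp only [Matrix.mul_assoc]

theorem norm_mul_J {m : ℕ} (hm : 0 < m) (A : Matrix (Idx m) (Idx m) ℂ) :
    ‖A‖ ≤ ‖A * (Complex.I • cplx (Omega m))‖ := by
  haveI : Nonempty (Idx m) := ⟨(⟨0, hm⟩, 0)⟩
  have h1 : (Complex.I • cplx (Omega m)) * (Complex.I • cplx (Omega m)) = 1 := by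
    rw [Matrix.smul_mul, Matrix.mul_smul, smul_smul, Complex.I_mul_I, ← cplx_mul, Omega_sq]
    ext i j; by_cases h : i = j <;> simp [cplx, Matrix.one_apply, h]
  have h2 : star (Complex.I • cplx (Omega m)) = Complex.I • cplx (Omega m) := by
    rw [star_eq_conjTranspose, conjTranspose_smul, ← cplx_transpose, Omega_transpose]
    ext i j; simp [cplx]
  have h3 : ‖Complex.I • cplx (Omega m)‖ = 1 := by
    apply CStarRing.norm_of_mem_unitary
    rw [Unitary.mem_iff, h2]
    exact ⟨h1, h1⟩
  calc ‖A‖ = ‖A * (Complex.I • cplx (Omega m)) * (Complex.I • cplx (Omega m))‖ := by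
        rw [Matrix.mul_assoc, h1, Matrix.mul_one]
    _ ≤ _ := (norm_mul_le _ _).trans (by rw [h3, mul_one])

end Aux

/-- With `K_k := 2·(2iΩV_k - I)⁻¹`, if
`‖K₁ - K₂‖∞ < e^{-2 d_max}·‖S‖∞⁻²` then
`‖H₁ - H₂‖∞ ≤ (1/2)·e^{2 d_max}·‖S‖∞²·‖K₁ - K₂‖∞·
  (1 + (e^{2 d_max}‖S‖∞²(1 - e^{-2 d_max}) + ‖K₁ - K₂‖∞)/(e^{-2 d_max}‖S‖∞⁻² - ‖K₁ - K₂‖∞))`. -/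
theorem statement7 {m : ℕ} (hm : 0 < m)
    (S₁ S₂ : Matrix (Idx m) (Idx m) ℝ)
    (hS₁ : S₁ * Omega m * S₁ᵀ = Omega m) (hS₂ : S₂ * Omega m * S₂ᵀ = Omega m)
    (d₁ d₂ : Fin m → ℝ) (hd₁ : ∀ i, 0 < d₁ i) (hd₂ : ∀ i, 0 < d₂ i)
    (H₁ H₂ : Matrix (Idx m) (Idx m) ℝ)
    (hH₁ : H₁ = (S₁⁻¹)ᵀ * pairDiag d₁ * S₁⁻¹) (hH₂ : H₂ = (S₂⁻¹)ᵀ * pairDiag d₂ * S₂⁻¹)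
    (V₁ V₂ : Matrix (Idx m) (Idx m) ℝ)
    (hV₁ : V₁ = (1/2 : ℝ) • (S₁ * pairDiag (fun i => rcoth (d₁ i)) * S₁ᵀ))
    (hV₂ : V₂ = (1/2 : ℝ) • (S₂ * pairDiag (fun i => rcoth (d₂ i)) * S₂ᵀ))
    (K₁ K₂ : Matrix (Idx m) (Idx m) ℂ)
    (hK₁ : K₁ = (2 : ℂ) • ((2 * Complex.I) • (cplx (Omega m) * cplx V₁) - 1)⁻¹)
    (hK₂ : K₂ = (2 : ℂ) • ((2 * Complex.I) • (cplx (Omega m) * cplx V₂) - 1)⁻¹)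
    (dmax : ℝ) (hdmax_le : ∀ i, d₁ i ≤ dmax) (hdmax_mem : ∃ i, d₁ i = dmax)
    (hKK : spNorm (K₁ - K₂) < Real.exp (-2 * dmax) * (spNorm S₁ ^ 2)⁻¹) :
    spNorm (H₁ - H₂) ≤
      (1/2) * Real.exp (2 * dmax) * spNorm S₁ ^ 2 * spNorm (K₁ - K₂) *
        (1 + (Real.exp (2 * dmax) * spNorm S₁ ^ 2 * (1 - Real.exp (-2 * dmax))
              + spNorm (K₁ - K₂)) /
            (Real.exp (-2 * dmax) * (spNorm S₁ ^ 2)⁻¹ - spNorm (K₁ - K₂))) := by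

  obtain ⟨T₁, T₁', a1, a2, a3, a4, a5⟩ := conc S₁ hS₁ d₁ hd₁ H₁ V₁ hH₁ hV₁ K₁ hK₁
  obtain ⟨T₂, T₂', b1, b2, b3, b4, b5⟩ := conc S₂ hS₂ d₂ hd₂ H₂ V₂ hH₂ hV₂ K₂ hK₂
  haveI : Nonempty (Idx m) := ⟨(⟨0, hm⟩, 0)⟩
  have hN : 0 < spNorm S₁ ^ 2 := by
    have h0 : 0 ≤ spNorm (K₁ - K₂) := norm_nonneg _
    by_contra hcon
    have : spNorm S₁ ^ 2 = 0 := le_antisymm (not_lt.1 hcon) (sq_nonneg _)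
    rw [this, _root_.inv_zero, mul_zero] at hKK
    linarith
  obtain ⟨i₀, hi₀⟩ := hdmax_mem
  have hd0 : 0 ≤ dmax := hi₀ ▸ (hd₁ i₀).le
  refine le_trans ?_ (abs_main T₁ T₁' T₂ T₂' a1 a2 b1 b2 (fun p => sgn2 p.2 * d₁ p.1)
    (fun p => sgn2 p.2 * d₂ p.1) dmax (spNorm S₁ ^ 2) (spNorm (K₁ - K₂)) hd0 hN ?_ (a3 hm)
    K₁ K₂ a4 b4 (spNorm_eq _) hKK)
  · rw [← a5, ← b5, ← Matrix.sub_mul, ← cplx_sub]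
    exact (norm_le_cplx _).trans (norm_mul_J hm _)
  · intro p
    rw [abs_mul, abs_of_pos (hd₁ _)]
    have : |sgn2 p.2| = 1 := by
      unfold sgn2; split_ifs <;> simp
    rw [this, one_mul]
    exact hdmax_le _
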